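/- Assume η₁ > 0 satisfies: (i) a₀·y − a₁·(y − a₁·η₁) < 0 for every y ≥ 1−y₀; (ii) η₁ < x₀ − y₀; (iii) f₁(y₀ + a₁·η₁) < x₀. Let x, y ∈ [1−x₀, x₀] with x < y and y − x < η₁, let ω ∈ Σ and let u be a natural number such that f^n_ω(y) ≤ x₀ for all n ≤ u. Then |f^n_ω(x) − f^n_ω(y)| ≤ a₁·(y − x) for all n ≤ u. -/

import Mathlib

/-
Formalization of the Alsedà–Misiurewicz system setup:
`f0, f1` are the piecewise-linear interval homeomorphisms, `iter` the random
iteration along ω ∈ Σ = {0,1}^ℕ, `IsKernel` characterises the family x ↦ ℙ_x by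
its values on cylinder sets, `Pop` is the Markov operator (as a set function),
`Stationary` expresses P-invariance for probability measures on (0,1), `U` is
the dual operator, and `A1`–`A4` are the assumptions of the paper.
-/

open MeasureTheory Filter Set
open scoped ENNReal Topology

namespace AM

noncomputable def f0 (x₀ y₀ : ℝ) (x : ℝ) : ℝ :=
  if x ≤ x₀ then (y₀ / x₀) * x else ((1 - y₀) / (1 - x₀)) * (x - 1) + 1

noncomputable def f1 (x₀ y₀ : ℝ) (x : ℝ) : ℝ := 1 - f0 x₀ y₀ (1 - x)

/-- `fb b` is `f₁` if `b = true`, and `f₀` if `b = false`. -/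
noncomputable def fb (x₀ y₀ : ℝ) (b : Bool) : ℝ → ℝ :=
  if b then f1 x₀ y₀ else f0 x₀ y₀

/-- `iter x₀ y₀ ω n x = f^n_ω(x) = f_{ω (n-1)} ∘ ⋯ ∘ f_{ω 0} (x)`, with `f^0_ω = id`. -/
noncomputable def iter (x₀ y₀ : ℝ) (ω : ℕ → Bool) : ℕ → ℝ → ℝ
  | 0, x => x
  | n + 1, x => fb x₀ y₀ (ω n) (iter x₀ y₀ ω n x)

/-- `cylProb x₀ y₀ p₀ p₁ x w = p_{i₁}(x) p_{i₂}(f_{i₁} x) ⋯` for the word `w = (i₁, …, i_k)`. -/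
noncomputable def cylProb (x₀ y₀ : ℝ) (p₀ p₁ : ℝ → ℝ) : ℝ → List Bool → ℝ
  | _, [] => 1
  | x, b :: w => (if b then p₁ x else p₀ x) * cylProb x₀ y₀ p₀ p₁ (fb x₀ y₀ b x) w

/-- The cylinder set of sequences starting with the word `w`. -/
def cyl (w : List Bool) : Set (ℕ → Bool) := {ω | ∀ j : Fin w.length, ω j = w.get j}

/-- `IsKernel x₀ y₀ p₀ p₁ Pm` says that `Pm x = ℙ_x` for all `x ∈ (0,1)`, i.e. `Pm x` gives
every cylinder set its prescribed probability (this determines `Pm x` uniquely and makes it a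
probability measure, since the empty word gives `Pm x univ = 1`). -/
def IsKernel (x₀ y₀ : ℝ) (p₀ p₁ : ℝ → ℝ) (Pm : ℝ → Measure (ℕ → Bool)) : Prop :=
  ∀ x ∈ Ioo (0:ℝ) 1, ∀ w : List Bool,
    Pm x (cyl w) = ENNReal.ofReal (cylProb x₀ y₀ p₀ p₁ x w)

/-- The Markov operator `P`, as a set function:
`Pop μ A = ∫_{f₀⁻¹(A)} p₀ dμ + ∫_{f₁⁻¹(A)} p₁ dμ`. -/
noncomputable def Pop (x₀ y₀ : ℝ) (p₀ p₁ : ℝ → ℝ) (μ : Measure ℝ) (A : Set ℝ) : ℝ≥0∞ :=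
  (∫⁻ x in f0 x₀ y₀ ⁻¹' A, ENNReal.ofReal (p₀ x) ∂μ) +
    ∫⁻ x in f1 x₀ y₀ ⁻¹' A, ENNReal.ofReal (p₁ x) ∂μ

/-- A stationary (P-invariant) Borel probability measure on (0,1). -/
def Stationary (x₀ y₀ : ℝ) (p₀ p₁ : ℝ → ℝ) (μ : Measure ℝ) : Prop :=
  IsProbabilityMeasure μ ∧ μ (Ioo 0 1) = 1 ∧
    ∀ A : Set ℝ, MeasurableSet A → A ⊆ Ioo 0 1 → μ A = Pop x₀ y₀ p₀ p₁ μ A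

/-- The dual operator `Uφ(x) = p₀(x) φ(f₀ x) + p₁(x) φ(f₁ x)`. -/
noncomputable def U (x₀ y₀ : ℝ) (p₀ p₁ : ℝ → ℝ) (φ : ℝ → ℝ) : ℝ → ℝ :=
  fun x => p₀ x * φ (f0 x₀ y₀ x) + p₁ x * φ (f1 x₀ y₀ x)

/-- Assumption (A1): `1/2 < x₀ < 1` and `1/2 ≤ y₀ < x₀`. -/
def A1 (x₀ y₀ : ℝ) : Prop := 1/2 < x₀ ∧ x₀ < 1 ∧ 1/2 ≤ y₀ ∧ y₀ < x₀

/-- Assumption (A2): Dini continuity of `p₀, p₁`; `β` is a modulus of continuity for both, with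
`∑ₙ β(C tⁿ) < ∞` for all `C ≥ 0`, `0 < t < 1`. (Such a `β` exists iff the least modulus of
continuity has this summability property.) -/
def A2 (p₀ p₁ : ℝ → ℝ) : Prop :=
  ∃ β : ℝ → ℝ,
    (∀ t : ℝ, ∀ x ∈ Icc (0:ℝ) 1, ∀ y ∈ Icc (0:ℝ) 1, |x - y| ≤ t →
      |p₀ x - p₀ y| ≤ β t ∧ |p₁ x - p₁ y| ≤ β t) ∧
    (∀ C : ℝ, 0 ≤ C → ∀ t : ℝ, 0 < t → t < 1 → Summable fun n : ℕ => β (C * t ^ n))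

/-- Assumption (A3): `p₀, p₁` are continuous, `p₀ + p₁ = 1`, and `0 < pᵢ < 1` on `[0,1]`. -/
def A3 (p₀ p₁ : ℝ → ℝ) : Prop :=
  ContinuousOn p₀ (Icc 0 1) ∧ ContinuousOn p₁ (Icc 0 1) ∧
    ∀ x ∈ Icc (0:ℝ) 1, p₀ x + p₁ x = 1 ∧ 0 < p₀ x ∧ p₀ x < 1 ∧ 0 < p₁ x ∧ p₁ x < 1

/-- Assumption (A4): the average Lyapunov exponents at 0 and 1 are positive
(`a₀ = y₀/x₀`, `a₁ = (1-y₀)/(1-x₀)`). -/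
def A4 (x₀ y₀ : ℝ) (p₀ p₁ : ℝ → ℝ) : Prop :=
  0 < p₀ 0 * Real.log (y₀ / x₀) + p₁ 0 * Real.log ((1 - y₀) / (1 - x₀)) ∧
    0 < p₀ 1 * Real.log ((1 - y₀) / (1 - x₀)) + p₁ 1 * Real.log (y₀ / x₀)

end AM

namespace AM

/-- Below the breakpoint `x₀`, the map `f₀` is linear with slope `a₀`. -/
lemma f0_of_le {x₀ y₀ x : ℝ} (h : x ≤ x₀) : f0 x₀ y₀ x = y₀ / x₀ * x := if_pos h

/-- Above the breakpoint `1 - x₀`, the map `f₁` is affine with slope `a₀`. -/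
lemma f1_of_ge {x₀ y₀ x : ℝ} (h : 1 - x₀ ≤ x) :
    f1 x₀ y₀ x = 1 - y₀ / x₀ * (1 - x) := by
  rw [f1, f0_of_le (by linarith)]

/-- Below the breakpoint `1 - x₀`, the map `f₁` is linear with slope `a₁`. -/
lemma f1_of_lt {x₀ y₀ x : ℝ} (h : x < 1 - x₀) :
    f1 x₀ y₀ x = (1 - y₀) / (1 - x₀) * x := by
  rw [f1, f0, if_neg (by linarith)]
  ring

/-- Two points `x < y` are `δ`-controlled if their distance is at most `a₁ δ` and their relative
distance `(y - x) / y` is at most `δ / (1 - x₀)`. -/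
structure Controlled (x₀ y₀ δ x y : ℝ) : Prop where
  lt : x < y
  sub_le : y - x ≤ (1 - y₀) / (1 - x₀) * δ
  sub_mul_le : (y - x) * (1 - x₀) ≤ δ * y

variable {x₀ y₀ δ x y : ℝ}

lemma Controlled.map_f0 (hA1 : A1 x₀ y₀) (h : Controlled x₀ y₀ δ x y) (hy : y ≤ x₀) :
    Controlled x₀ y₀ δ (f0 x₀ y₀ x) (f0 x₀ y₀ y) := by
  obtain ⟨hlt, hsub, hmul⟩ := h
  obtain ⟨h1, h2, h3, h4⟩ := hA1
  have ha0 : 0 < y₀ / x₀ := div_pos (by linarith) (by linarith)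
  have ha1 : y₀ / x₀ < 1 := (div_lt_one (by linarith)).2 h4
  rw [f0_of_le hy, f0_of_le (hlt.le.trans hy)]
  generalize y₀ / x₀ = a at *
  refine ⟨by gcongr, ?_, ?_⟩
  · nlinarith [mul_pos (sub_pos.2 ha1) (sub_pos.2 hlt)]
  · nlinarith [mul_le_mul_of_nonneg_left hmul ha0.le]

lemma Controlled.map_f1 (hA1 : A1 x₀ y₀) (hδ : 0 < δ)
    (hsmall : (1 - y₀) / (1 - x₀) * δ ≤ ((1 - y₀) / (1 - x₀) - y₀ / x₀) * (1 - x₀))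
    (h : Controlled x₀ y₀ δ x y) :
    Controlled x₀ y₀ δ (f1 x₀ y₀ x) (f1 x₀ y₀ y) := by
  obtain ⟨hlt, hsub, hmul⟩ := h
  obtain ⟨h1, h2, h3, h4⟩ := hA1
  have ha0 : 0 < y₀ / x₀ := div_pos (by linarith) (by linarith)
  have ha1 : y₀ / x₀ < 1 := (div_lt_one (by linarith)).2 h4
  have hb : 1 < (1 - y₀) / (1 - x₀) := (one_lt_div (by linarith)).2 (by linarith)
  have hc : 0 < 1 - x₀ := by linarith
  have hglue : 1 - y₀ / x₀ * x₀ = (1 - y₀) / (1 - x₀) * (1 - x₀) := by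
    rw [div_mul_cancel₀ _ (by linarith), div_mul_cancel₀ _ hc.ne']
  rcases le_or_gt (1 - x₀) x with hx | hx
  · rw [f1_of_ge hx, f1_of_ge (hx.trans hlt.le)]
    generalize y₀ / x₀ = a at *
    refine ⟨by nlinarith, ?_, ?_⟩
    · nlinarith [mul_pos (sub_pos.2 ha1) (sub_pos.2 hlt)]
    · nlinarith [mul_le_mul_of_nonneg_left hmul ha0.le, mul_pos hδ (sub_pos.2 ha1)]
  · rcases le_or_gt (1 - x₀) y with hy | hy
    · rw [f1_of_lt hx, f1_of_ge hy]
      generalize y₀ / x₀ = a at *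
      generalize hb_eq : (1 - y₀) / (1 - x₀) = b at *
      obtain ⟨c, rfl⟩ : ∃ c, x₀ = 1 - c := ⟨1 - x₀, by ring⟩
      obtain ⟨s, rfl⟩ : ∃ s, x = c - s := ⟨c - x, by ring⟩
      obtain ⟨t, rfl⟩ : ∃ t, y = c + t := ⟨y - c, by ring⟩
      simp only [sub_sub_cancel] at *
      have hs : 0 < s := by linarith
      have ht : 0 ≤ t := by linarith
      have hb0 : 0 < b := by linarith
      have hdist : 1 - a * (1 - (c + t)) - b * (c - s) = b * s + a * t := by
        linear_combination hglue
      have himage : 1 - a * (1 - (c + t)) = b * c + a * t := by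
        linear_combination hglue
      have hscaled := mul_le_mul_of_nonneg_left hmul hb0.le
      have hsmall' := mul_le_mul_of_nonneg_left hsmall ht
      have hδc : δ < c := by nlinarith [mul_pos ha0 hc]
      have hab : 0 < b - a := by linarith
      refine ⟨?_, ?_, ?_⟩
      · nlinarith [mul_pos hb0 hs, mul_nonneg ha0.le ht]
      · rw [hdist, sub_sub_cancel, hb_eq]
        refine le_of_mul_le_mul_right ?_ hc
        nlinarith
      · rw [hdist, himage]
        nlinarith [mul_nonneg (mul_nonneg hab.le (sub_nonneg.2 hδc.le)) ht]
    · rw [f1_of_lt hx, f1_of_lt hy]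
      generalize y₀ / x₀ = a at *
      generalize hb_eq : (1 - y₀) / (1 - x₀) = b at *
      have hb0 : 0 < b := by linarith
      have hdist : y - x ≤ δ := by
        refine le_of_mul_le_mul_right ?_ hc
        nlinarith [mul_pos hδ (sub_pos.2 hy)]
      refine ⟨by gcongr, ?_, ?_⟩
      · rw [hb_eq]
        nlinarith [mul_le_mul_of_nonneg_left hdist hb0.le]
      · nlinarith [mul_le_mul_of_nonneg_left hmul hb0.le]

/-- Control is preserved along an orbit as long as the upper point stays below `x₀`. -/
lemma Controlled.iter (hA1 : A1 x₀ y₀) (hδ : 0 < δ)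
    (hsmall : (1 - y₀) / (1 - x₀) * δ ≤ ((1 - y₀) / (1 - x₀) - y₀ / x₀) * (1 - x₀))
    (h : Controlled x₀ y₀ δ x y) (ω : ℕ → Bool) (n : ℕ)
    (hn : ∀ k < n, AM.iter x₀ y₀ ω k y ≤ x₀) :
    Controlled x₀ y₀ δ (AM.iter x₀ y₀ ω n x) (AM.iter x₀ y₀ ω n y) := by
  induction n with
  | zero => exact h
  | succ n ih =>
    have ih := ih fun k hk => hn k (by omega)
    simp only [AM.iter]
    cases ω n
    · simpa [fb] using ih.map_f0 hA1 (hn n (by omega))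
    · simpa [fb] using ih.map_f1 hA1 hδ hsmall

end AM

/-- Lemma 2: with `η₁` as in Statement 4, if `x, y ∈ [1−x₀, x₀]`, `x < y`,
`y − x < η₁`, and `f^n_ω(y) ≤ x₀` for all `n ≤ u`, then
`|f^n_ω(x) − f^n_ω(y)| ≤ a₁ (y − x)` for all `n ≤ u`. -/
theorem stmt7 (x₀ y₀ : ℝ) (hA1 : AM.A1 x₀ y₀)
    (η₁ : ℝ) (hη : 0 < η₁)
    (hi : ∀ y : ℝ, 1 - y₀ ≤ y →
      (y₀ / x₀) * y - ((1 - y₀) / (1 - x₀)) * (y - ((1 - y₀) / (1 - x₀)) * η₁) < 0)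
    (hii : η₁ < x₀ - y₀)
    (hiii : AM.f1 x₀ y₀ (y₀ + ((1 - y₀) / (1 - x₀)) * η₁) < x₀)
    (x y : ℝ) (hx : x ∈ Set.Icc (1 - x₀) x₀) (hy : y ∈ Set.Icc (1 - x₀) x₀)
    (hxy : x < y) (hclose : y - x < η₁)
    (ω : ℕ → Bool) (u : ℕ) (hu : ∀ n ≤ u, AM.iter x₀ y₀ ω n y ≤ x₀) :
    ∀ n ≤ u, |AM.iter x₀ y₀ ω n x - AM.iter x₀ y₀ ω n y| ≤
      ((1 - y₀) / (1 - x₀)) * (y - x) := by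
  have hδ : 0 < y - x := sub_pos.2 hxy
  have hc : 0 < 1 - x₀ := sub_pos.2 hA1.2.1
  have hb : 1 < (1 - y₀) / (1 - x₀) := (one_lt_div hc).2 (by linarith [hA1.2.2.2])
  have hsmall : (1 - y₀) / (1 - x₀) * (y - x) ≤
      ((1 - y₀) / (1 - x₀) - y₀ / x₀) * (1 - x₀) := by
    have h := hi (1 - y₀) le_rfl
    have heq : 1 - y₀ = (1 - y₀) / (1 - x₀) * (1 - x₀) := (div_mul_cancel₀ _ hc.ne').symm
    generalize (1 - y₀) / (1 - x₀) = b at *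
    rw [heq] at h
    have hb0 : 0 < b := by linarith
    have hη₁ : b * η₁ < (b - y₀ / x₀) * (1 - x₀) := by
      refine lt_of_mul_lt_mul_left ?_ hb0.le
      linarith
    exact (mul_le_mul_of_nonneg_left hclose.le hb0.le).trans hη₁.le
  have hstart : AM.Controlled x₀ y₀ (y - x) x y :=
    ⟨hxy, by nlinarith, mul_le_mul_of_nonneg_left hy.1 hδ.le⟩
  intro n hn
  have h := hstart.iter hA1 hδ hsmall ω n fun k hk => hu k (by omega)
  rw [abs_sub_comm, abs_of_pos (sub_pos.2 h.lt)]
  exact h.sub_le
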